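/- Let κ be an infinite cardinal. If cov(𝒩) = cof(𝒩) = κ, then there exists a ℚ-linear subspace H of ℝⁿ (viewing ℝⁿ as a vector space over the field ℚ of rational numbers) that is a κ-Sierpiński set, i.e., a κ-Luzin set for 𝒩. -/

import Mathlib

open MeasureTheory Cardinal

/-- `cov(ℐ)`: the least cardinality of a family `F ⊆ I` covering the whole space. -/
noncomputable def idealCov {X : Type*} (I : Set (Set X)) : Cardinal :=
  sInf {c : Cardinal | ∃ F : Set (Set X), F ⊆ I ∧ ⋃₀ F = Set.univ ∧ #F = c}

/-- `cof(ℐ)`: the least cardinality of a family `F ⊆ I` cofinal in `I` under inclusion. -/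
noncomputable def idealCof {X : Type*} (I : Set (Set X)) : Cardinal :=
  sInf {c : Cardinal | ∃ F : Set (Set X), F ⊆ I ∧ (∀ A ∈ I, ∃ B ∈ F, A ⊆ B) ∧ #F = c}

open scoped Pointwise

theorem mk_Iio_ord_toType_lt {κ : Cardinal.{0}} (i : κ.ord.ToType) : #(Set.Iio i) < κ := by
  simpa using mk_Iio_lt i (by simp)

/-- Transfinite recursion along `κ`: if every set `S` of size `< κ` admits a point `v` with
`P i S v`, then there is a `κ`-sequence each of whose terms is good for its predecessors. -/
theorem exists_forall_image_Iio {V : Type} {κ : Cardinal.{0}}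
    (P : κ.ord.ToType → Set V → V → Prop) (hP : ∀ i (S : Set V), #S < κ → ∃ v, P i S v) :
    ∃ x : κ.ord.ToType → V, ∀ i, P i (x '' Set.Iio i) (x i) := by
  classical
  rcases isEmpty_or_nonempty κ.ord.ToType with he | ⟨⟨i₀⟩⟩
  · exact ⟨fun i => he.elim i, fun i => he.elim i⟩
  have hV : Nonempty V := by
    obtain ⟨v, -⟩ := hP i₀ ∅ (by simpa using zero_le.trans_lt (mk_Iio_ord_toType_lt i₀))
    exact ⟨v⟩
  have hP' : ∀ i (S : Set V), ∃ v, #S < κ → P i S v := fun i S => by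
    by_cases h : #S < κ
    · obtain ⟨v, hv⟩ := hP i S h
      exact ⟨v, fun _ => hv⟩
    · exact ⟨hV.some, fun h' => absurd h' h⟩
  choose f hf using hP'
  have hwf : WellFounded ((· < ·) : κ.ord.ToType → κ.ord.ToType → Prop) := wellFounded_lt
  let x : κ.ord.ToType → V :=
    hwf.fix fun i rec => f i {v | ∃ j, ∃ h : j < i, rec j h = v}
  have hx : ∀ i, x i = f i (x '' Set.Iio i) := fun i => by
    have h : x i = f i {v | ∃ j, ∃ _ : j < i, x j = v} := hwf.fix_eq _ i
    rw [h]
    congr 1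
    ext v
    simp
  refine ⟨x, fun i => ?_⟩
  have h := hf i (x '' Set.Iio i) (mk_image_le.trans_lt (mk_Iio_ord_toType_lt i))
  rwa [← hx i] at h

theorem mk_span_rat_le {V : Type} [AddCommGroup V] [Module ℚ V] (S : Set V) :
    #(Submodule.span ℚ S) ≤ max #S ℵ₀ := by
  rcases S.eq_empty_or_nonempty with rfl | hS
  · rw [Submodule.span_empty]
    exact (mk_le_aleph0 (α := (⊥ : Submodule ℚ V))).trans (le_max_right _ _)
  · have : Nonempty S := hS.to_subtype
    rw [Finsupp.span_eq_range_linearCombination]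
    refine (mk_le_of_surjective (LinearMap.surjective_rangeRestrict
      (Finsupp.linearCombination ℚ ((↑) : S → V)))).trans ?_
    simp

/-- A vector in the span of an initial part of a sequence already lies in the span of
the terms up to some index in that part. -/
theorem eq_zero_or_mem_span_image_Iic {ι R V : Type*} [LinearOrder ι] [Semiring R]
    [AddCommMonoid V] [Module R V] (x : ι → V) (s : Set ι) {v : V}
    (hv : v ∈ Submodule.span R (x '' s)) :
    v = 0 ∨ ∃ i ∈ s, v ∈ Submodule.span R (x '' Set.Iic i) := by
  induction hv using Submodule.span_induction with
  | mem v hv =>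
    obtain ⟨i, hi, rfl⟩ := hv
    exact .inr ⟨i, hi, Submodule.subset_span ⟨i, Set.self_mem_Iic, rfl⟩⟩
  | zero => exact .inl rfl
  | add v w _ _ hv hw =>
    rcases hv with rfl | ⟨i, hi, hv⟩
    · simpa using hw
    rcases hw with rfl | ⟨j, hj, hw⟩
    · exact .inr ⟨i, hi, by simpa using hv⟩
    have mono : ∀ {a b : ι}, a ≤ b →
        Submodule.span R (x '' Set.Iic a) ≤ Submodule.span R (x '' Set.Iic b) := fun h =>
      Submodule.span_mono (Set.image_mono (Set.Iic_subset_Iic.2 h))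
    rcases le_total i j with h | h
    · exact .inr ⟨j, hj, add_mem (mono h hv) hw⟩
    · exact .inr ⟨i, hi, add_mem hv (mono h hw)⟩
  | smul c v _ hv =>
    rcases hv with rfl | ⟨i, hi, hv⟩
    · simp
    · exact .inr ⟨i, hi, Submodule.smul_mem _ c hv⟩

/-- If each term `x i` avoids all `q • N j + w` with `j ≤ i` and `w` in the span of the earlier
terms, then the span of `x` meets `N j` only inside the span of the terms before `j`. -/
theorem mem_span_image_Iio_of_mem {ι K V : Type*} [LinearOrder ι] [WellFoundedLT ι]
    [DivisionRing K] [AddCommGroup V] [Module K V] (x : ι → V) (N : ι → Set V)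
    (hx : ∀ i, ∀ j ≤ i, ∀ q : K, ∀ w ∈ Submodule.span K (x '' Set.Iio i), ∀ u ∈ N j,
      x i ≠ q • u + w)
    {j : ι} {v : V} (hv : v ∈ Submodule.span K (Set.range x)) (hN : v ∈ N j) :
    v ∈ Submodule.span K (x '' Set.Iio j) := by
  have key : ∀ i, v ∈ Submodule.span K (x '' Set.Iic i) →
      v ∈ Submodule.span K (x '' Set.Iio j) := fun i => by
    induction i using WellFoundedLT.induction with
    | ind i ih =>
      intro hi
      rcases lt_or_ge i j with hij | hij
      · exact Submodule.span_mono (Set.image_mono (Set.Iic_subset_Iio.2 hij)) hi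
      rw [← Set.Iio_insert, Set.image_insert_eq, Submodule.mem_span_insert] at hi
      obtain ⟨q, w, hw, hvw⟩ := hi
      rcases eq_or_ne q 0 with rfl | hq
      · rw [zero_smul, zero_add] at hvw
        rw [← hvw] at hw
        rcases eq_zero_or_mem_span_image_Iic x _ hw with h0 | ⟨k, hk, hvk⟩
        · rw [h0]
          exact zero_mem _
        · exact ih k hk hvk
      · refine absurd ?_ (hx i j hij q⁻¹ (-(q⁻¹ • w))
          (neg_mem (Submodule.smul_mem _ _ hw)) v hN)
        rw [hvw, smul_add, inv_smul_smul₀ hq, add_neg_cancel_right]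
  rw [← Set.image_univ] at hv
  rcases eq_zero_or_mem_span_image_Iic x _ hv with h0 | ⟨k, -, hvk⟩
  · rw [h0]
    exact zero_mem _
  · exact key k hvk

theorem exists_notMem_of_mk_lt_idealCov {X ι : Type} {I : Set (Set X)} (A : ι → Set X)
    (hA : ∀ i, A i ∈ I) (hι : #ι < idealCov I) : ∃ v, ∀ i, v ∉ A i := by
  by_contra! h
  refine absurd (mk_range_le.trans_lt hι) (not_lt.2 (csInf_le' ⟨Set.range A, ?_, ?_, rfl⟩))
  · rintro _ ⟨i, rfl⟩
    exact hA i
  · exact Set.eq_univ_of_forall fun v => (h v).elim fun i hi => ⟨A i, ⟨i, rfl⟩, hi⟩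

theorem aleph0_lt_idealCov_null {X : Type*} [MeasurableSpace X] (μ : Measure X) [NeZero μ]
    (h : ℵ₀ ≤ idealCov {A : Set X | μ A = 0}) : ℵ₀ < idealCov {A : Set X | μ A = 0} := by
  refine h.lt_of_ne fun heq => ?_
  have hne : {c : Cardinal | ∃ F : Set (Set X), F ⊆ {A : Set X | μ A = 0} ∧
      ⋃₀ F = Set.univ ∧ #F = c}.Nonempty := by
    by_contra hn
    rw [Set.not_nonempty_iff_eq_empty] at hn
    rw [idealCov, hn, Cardinal.sInf_empty] at heq
    exact aleph0_ne_zero heq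
  obtain ⟨F, hF, hU, hc⟩ := csInf_mem hne
  have hFc : F.Countable := by
    rw [← le_aleph0_iff_set_countable, hc]
    exact heq.ge
  have h0 : μ (⋃₀ F) = 0 := (measure_sUnion_null_iff hFc).2 hF
  rw [hU] at h0
  exact NeZero.ne μ (Measure.measure_univ_eq_zero.1 h0)

theorem exists_cofinal_of_idealCof_eq {X : Type} {I : Set (Set X)} {κ : Cardinal.{0}}
    (h : idealCof I = κ) :
    ∃ N : κ.ord.ToType → Set X, (∀ i, N i ∈ I) ∧ ∀ A ∈ I, ∃ i, A ⊆ N i := by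
  have hne : {c : Cardinal | ∃ F : Set (Set X), F ⊆ I ∧ (∀ A ∈ I, ∃ B ∈ F, A ⊆ B) ∧
      #F = c}.Nonempty := ⟨_, I, subset_rfl, fun A hA => ⟨A, hA, subset_rfl⟩, rfl⟩
  obtain ⟨F, hF, hcof, hc⟩ := csInf_mem hne
  have hc' : #κ.ord.ToType = #F := by
    rw [mk_ord_toType, hc]
    exact h.symm
  obtain ⟨e⟩ := Cardinal.eq.1 hc'
  refine ⟨fun i => e i, fun i => hF (e i).2, fun A hA => ?_⟩
  obtain ⟨B, hB, hAB⟩ := hcof A hA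
  exact ⟨e.symm ⟨B, hB⟩, by simpa using hAB⟩

theorem volume_rat_smul_add_eq_zero {n : ℕ} {A : Set (Fin n → ℝ)} (hA : volume A = 0) (q : ℚ)
    (w : Fin n → ℝ) : volume ((fun u => q • u + w) '' A) = 0 := by
  have h : (fun u => q • u + w) '' A = (fun u => u + w) '' ((q : ℝ) • A) := by
    rw [← Set.image_smul, Set.image_image]
    simp only [Rat.cast_smul_eq_qsmul]
  rw [h, Set.image_add_right, measure_preimage_add_right, Measure.addHaar_smul, hA, mul_zero]

/-- If `cov(𝒩) = cof(𝒩) = κ`, then there exists a `ℚ`-linear subspace `H` of `ℝⁿ`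
which is a `κ`-Sierpiński set, i.e. a `κ`-Luzin set for `𝒩`. -/
theorem exists_sierpinski_subspace (n : ℕ) (hn : 1 ≤ n) (κ : Cardinal) (hκ : ℵ₀ ≤ κ)
    (hcov : idealCov {A : Set (Fin n → ℝ) | volume A = 0} = κ)
    (hcof : idealCof {A : Set (Fin n → ℝ) | volume A = 0} = κ) :
    ∃ H : Submodule ℚ (Fin n → ℝ),
      κ ≤ #(H : Set (Fin n → ℝ)) ∧
      ∀ B : Set (Fin n → ℝ), volume B = 0 → #(↥((H : Set (Fin n → ℝ)) ∩ B)) < κ := by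
  have : Nonempty (Fin n) := ⟨⟨0, hn⟩⟩
  have hκ' : ℵ₀ < κ := hcov ▸ aleph0_lt_idealCov_null volume (hcov.symm ▸ hκ)
  obtain ⟨N₀, hN₀, hcofN₀⟩ := exists_cofinal_of_idealCof_eq hcof
  let N : κ.ord.ToType → Set (Fin n → ℝ) := fun i => insert 0 (N₀ i)
  have hN : ∀ i, volume (N i) = 0 := fun i => by
    simp only [N, Set.insert_eq]
    exact measure_union_null (measure_singleton _) (hN₀ i)
  have hspan : ∀ S : Set (Fin n → ℝ), #S < κ → #(Submodule.span ℚ S) < κ := fun S hS =>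
    (mk_span_rat_le S).trans_lt (max_lt hS hκ')
  obtain ⟨x, hx⟩ := exists_forall_image_Iio
    (fun (i : κ.ord.ToType) (S : Set (Fin n → ℝ)) v => ∀ j ≤ i, ∀ q : ℚ,
      ∀ w ∈ Submodule.span ℚ S, ∀ u ∈ N j, v ≠ q • u + w) fun i S hS => by
    have hIic : #(Set.Iic i) < κ := by
      rw [← Set.Iio_insert]
      exact mk_insert_le.trans_lt
        (add_lt_of_lt hκ (mk_Iio_ord_toType_lt i) (one_lt_aleph0.trans hκ'))
    have hcard : #(Set.Iic i × ℚ × Submodule.span ℚ S) < κ := by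
      simp only [mk_prod, lift_id]
      exact mul_lt_of_lt hκ hIic (mul_lt_of_lt hκ (mk_le_aleph0.trans_lt hκ') (hspan S hS))
    obtain ⟨v, hv⟩ := exists_notMem_of_mk_lt_idealCov
      (I := {A : Set (Fin n → ℝ) | volume A = 0})
      (fun p : Set.Iic i × ℚ × Submodule.span ℚ S =>
        (fun u => p.2.1 • u + (p.2.2 : Fin n → ℝ)) '' N p.1)
      (fun p => volume_rat_smul_add_eq_zero (hN _) _ _) (hcov.symm ▸ hcard)
    exact ⟨v, fun j hj q w hw u hu h => hv (⟨j, hj⟩, q, ⟨w, hw⟩) ⟨u, hu, h.symm⟩⟩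
  have hx_notMem : ∀ i, x i ∉ Submodule.span ℚ (x '' Set.Iio i) := fun i h =>
    hx i i le_rfl 0 _ h 0 (Set.mem_insert _ _) (by simp)
  have hx_ne : ∀ i j, i < j → x i ≠ x j := fun i j hij h =>
    hx_notMem j (h ▸ Submodule.subset_span ⟨i, hij, rfl⟩)
  have hx_inj : Function.Injective x := fun i j h => by
    rcases lt_trichotomy i j with hij | hij | hij
    · exact absurd h (hx_ne i j hij)
    · exact hij
    · exact absurd h.symm (hx_ne j i hij)
  refine ⟨Submodule.span ℚ (Set.range x), ?_, fun B hB => ?_⟩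
  · calc κ = #(Set.range x) := by rw [mk_range_eq x hx_inj, mk_ord_toType]
      _ ≤ _ := mk_le_mk_of_subset Submodule.subset_span
  · obtain ⟨j, hj⟩ := hcofN₀ B hB
    refine (mk_le_mk_of_subset fun v hv => ?_).trans_lt
      (hspan (x '' Set.Iio j) (mk_image_le.trans_lt (mk_Iio_ord_toType_lt j)))
    exact mem_span_image_Iio_of_mem x N hx hv.1 (Set.mem_insert_of_mem _ (hj hv.2))
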